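/- Every gamma in PCl' has a symplectic Delta-encoding: there exist an additive group homomorphism lambda : V' -> ZMod d and a symplectic automorphism phi in Sp(V', omega') such that gamma(Delta_v) = zeta^((lambda v).val) * Delta_(phi v) for all v in V'. -/

import Mathlib

noncomputable section

namespace PaperPCl

/-- `d' = 2d` if `d` is even, `d' = d` if `d` is odd. -/
def dp (d : ℕ) : ℕ := if Even d then 2 * d else d

lemma d_dvd_dp (d : ℕ) : d ∣ dp d := by
  unfold dp; split
  · exact dvd_mul_left d 2
  · rfl

/-- The phase space `V = (ZMod d)^n × (ZMod d)^n`, vectors written `(q, p)`. -/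
abbrev V (d n : ℕ) := (Fin n → ZMod d) × (Fin n → ZMod d)

/-- Dot product of two vectors in `(ZMod d)^n`. -/
def dotp {d n : ℕ} (p q : Fin n → ZMod d) : ZMod d := ∑ i, p i * q i

/-- The standard symplectic form `omega((q1,p1),(q2,p2)) = p1·q2 - p2·q1`. -/
def omegaF {d n : ℕ} (v w : V d n) : ZMod d := dotp v.2 w.1 - dotp w.2 v.1

/-- Componentwise reduction mod `d`, `V' → V`. -/
def reduceV (d n : ℕ) (v : V (dp d) n) : V d n :=
  (fun i => ZMod.castHom (d_dvd_dp d) (ZMod d) (v.1 i),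
   fun i => ZMod.castHom (d_dvd_dp d) (ZMod d) (v.2 i))

/-- Componentwise `val`-lift `V → V'`. -/
def liftV (d n : ℕ) (u : V d n) : V (dp d) n :=
  (fun i => ((u.1 i).val : ZMod (dp d)), fun i => ((u.2 i).val : ZMod (dp d)))

/-- `zeta = exp(2 pi i / d)`. -/
def zeta (d : ℕ) : ℂ := Complex.exp (2 * Real.pi * Complex.I / d)

/-- `tau = exp(pi i / d)` if `d` is even, `tau = zeta^((d+1)/2)` if `d` is odd. -/
def tau (d : ℕ) : ℂ :=
  if Even d then Complex.exp (Real.pi * Complex.I / d) else zeta d ^ ((d + 1) / 2)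

/-- The Pauli matrix `D_(q,p) = X^q Z^p`, a `d^n × d^n` complex matrix. -/
def Dop (d n : ℕ) [NeZero d] (u : V d n) : Matrix (Fin n → ZMod d) (Fin n → ZMod d) ℂ :=
  fun r s => if r = s + u.1 then zeta d ^ (dotp u.2 s).val else 0

/-- The displacement operator `Delta_v = tau^(q·p) D_(vbar)` for `v = (q,p) ∈ V'`. -/
def Delta (d n : ℕ) [NeZero d] (v : V (dp d) n) : Matrix (Fin n → ZMod d) (Fin n → ZMod d) ℂ :=
  tau d ^ (dotp v.1 v.2).val • Dop d n (reduceV d n v)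

/-- The large Pauli group `P'`: the subgroup of invertible `d^n × d^n` complex matrices
generated by the scalar matrix `tau • 1` together with all `D_u`, `u ∈ V`. -/
def Pgrp (d n : ℕ) [NeZero d] : Subgroup (Matrix (Fin n → ZMod d) (Fin n → ZMod d) ℂ)ˣ :=
  Subgroup.closure {x | (x : Matrix (Fin n → ZMod d) (Fin n → ZMod d) ℂ)
      = tau d • (1 : Matrix (Fin n → ZMod d) (Fin n → ZMod d) ℂ)
    ∨ ∃ u : V d n, (x : Matrix (Fin n → ZMod d) (Fin n → ZMod d) ℂ) = Dop d n u}

/-- The underlying matrix of an element of `P'`. -/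
def matVal {d n : ℕ} [NeZero d] (g : ↥(Pgrp d n)) : Matrix (Fin n → ZMod d) (Fin n → ZMod d) ℂ :=
  ((g : (Matrix (Fin n → ZMod d) (Fin n → ZMod d) ℂ)ˣ) : Matrix (Fin n → ZMod d) (Fin n → ZMod d) ℂ)

/-- A function `γ : P' → P'` is center-respecting if `γ(z*g) = z*γ(g)`
for every `z` in the center of `P'`. -/
def CenterResp {d n : ℕ} [NeZero d] (γ : ↥(Pgrp d n) → ↥(Pgrp d n)) : Prop :=
  ∀ z ∈ Subgroup.center ↥(Pgrp d n), ∀ g, γ (z * g) = z * γ g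

/-- A group automorphism of `P'` is projective Clifford if it fixes the center pointwise. -/
def IsPCl {d n : ℕ} [NeZero d] (γ : ↥(Pgrp d n) ≃* ↥(Pgrp d n)) : Prop :=
  ∀ z ∈ Subgroup.center ↥(Pgrp d n), γ z = z

/-- A linear automorphism is symplectic if it preserves the standard symplectic form. -/
def IsSymp (d n : ℕ) (ψ : V d n ≃ₗ[ZMod d] V d n) : Prop :=
  ∀ u v : V d n, omegaF (ψ u) (ψ v) = omegaF u v

/-- `b` is a standard basis vector of `V`. -/
def IsStdBasis {d n : ℕ} (b : V d n) : Prop :=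
  (∃ i : Fin n, b = (Pi.single i 1, 0)) ∨ (∃ i : Fin n, b = (0, Pi.single i 1))

/-- If `w` reproduces the values of an alternating perfect form `ω` on a basis `b` modulo an element
`δ` of square zero, then some isometry of `ω` sends each `b i` to `w i` modulo `δ`. -/
lemma exists_isometry_congr {R M : Type*} [CommRing R] [AddCommGroup M] [Module R M] {m : ℕ}
    (b : Module.Basis (Fin m) R M) (ω : M →ₗ[R] M →ₗ[R] R) (halt : ∀ x, ω x x = 0)
    (hsurj : Function.Surjective ω) (δ : R) (hδ : δ * δ = 0) (w : Fin m → M)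
    (h : ∀ i j, ∃ c, ω (w i) (w j) - ω (b i) (b j) = δ * c) :
    ∃ φ : M →ₗ[R] M, (∀ u v, ω (φ u) (φ v) = ω u v) ∧ ∀ i, ∃ u, φ (b i) = w i + δ • u := by
  have hanti : ∀ x y, ω x y = -ω y x := fun x y => by
    have := halt (x + y)
    simp only [map_add, LinearMap.add_apply, halt] at this
    linear_combination this
  choose c hc using h
  choose u hu using fun j => hsurj (b.constr R fun i => -(if i < j then c i j else 0))
  have hub : ∀ i j, ω (u j) (b i) = -(if i < j then c i j else 0) := fun i j => by
    rw [hu, b.constr_basis]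
  set φ₀ := b.constr R w
  have hb : ∀ i, φ₀ (b i) = w i := fun i => b.constr_basis R w i
  have hcong : ∀ x y, δ * ω (φ₀ x) (φ₀ y) = δ * ω x y := by
    have key : δ • ω.compl₁₂ φ₀ φ₀ = δ • ω := by
      refine LinearMap.BilinForm.ext_basis b fun i j => ?_
      simp only [LinearMap.smul_apply, LinearMap.compl₁₂_apply, smul_eq_mul, hb]
      linear_combination δ * hc i j + c i j * hδ
    intro x y
    simpa using LinearMap.congr_fun₂ key x y
  refine ⟨b.constr R fun j => w j - δ • φ₀ (u j), ?_, fun i => ⟨-φ₀ (u i), ?_⟩⟩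
  · set φ := b.constr R fun j => w j - δ • φ₀ (u j) with hφ
    have hφb : ∀ i, φ (b i) = φ₀ (b i) - δ • φ₀ (u i) := fun i => by
      rw [hb, hφ, b.constr_basis]
    have key : ω.compl₁₂ φ φ = ω := by
      refine LinearMap.BilinForm.ext_basis b fun i j => ?_
      simp only [LinearMap.compl₁₂_apply, hφb, map_sub, map_smul, LinearMap.sub_apply,
        LinearMap.smul_apply, smul_eq_mul]
      have h₁ := hcong (b i) (u j)
      have h₂ := hcong (u i) (b j)
      rw [hanti (b i) (u j), hub] at h₁
      rw [hub] at h₂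
      have h₃ := hc i j
      have h₄ := hc j i
      rw [← hb, ← hb] at h₃ h₄
      rw [hanti (φ₀ (b j)), hanti (b j)] at h₄
      rcases lt_trichotomy i j with hij | rfl | hij
      · simp only [hij, hij.not_gt, if_true, if_false] at h₁ h₂
        linear_combination h₃ - h₁ - h₂ + ω (φ₀ (u i)) (φ₀ (u j)) * hδ
      · simp only [lt_irrefl, if_false, halt] at *
        linear_combination -h₁ - h₂
      · simp only [hij, hij.not_gt, if_true, if_false] at h₁ h₂
        linear_combination -h₄ - h₁ - h₂ + ω (φ₀ (u i)) (φ₀ (u j)) * hδ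
    exact fun x y => LinearMap.congr_fun₂ key x y
  · rw [b.constr_basis, smul_neg, sub_eq_add_neg]

section Form

variable {d n : ℕ}

lemma dotp_eq_dotProduct (p q : Fin n → ZMod d) : dotp p q = dotProduct p q := rfl

/-- The standard symplectic form as a bilinear map. -/
def omegaLin (d n : ℕ) : V d n →ₗ[ZMod d] V d n →ₗ[ZMod d] ZMod d :=
  LinearMap.mk₂ _ omegaF
    (fun u v w => by
      simp only [omegaF, dotp_eq_dotProduct, Prod.fst_add, Prod.snd_add, add_dotProduct,
        dotProduct_add]; ring)
    (fun c v w => by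
      simp only [omegaF, dotp_eq_dotProduct, Prod.smul_fst, Prod.smul_snd, smul_dotProduct,
        dotProduct_smul, smul_eq_mul]; ring)
    (fun u v w => by
      simp only [omegaF, dotp_eq_dotProduct, Prod.fst_add, Prod.snd_add, add_dotProduct,
        dotProduct_add]; ring)
    (fun c v w => by
      simp only [omegaF, dotp_eq_dotProduct, Prod.smul_fst, Prod.smul_snd, smul_dotProduct,
        dotProduct_smul, smul_eq_mul]; ring)

lemma omegaLin_apply (v w : V d n) : omegaLin d n v w = omegaF v w := rfl

lemma omegaF_self (v : V d n) : omegaF v v = 0 := sub_self _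

lemma omegaF_swap (v w : V d n) : omegaF v w = -omegaF w v := (neg_sub _ _).symm

lemma omegaLin_surjective : Function.Surjective (omegaLin d n) := by
  intro f
  refine ⟨(fun i => -f (0, Pi.single i 1), fun i => f (Pi.single i 1, 0)), ?_⟩
  ext i <;>
  simp [omegaLin_apply, omegaF, dotp_eq_dotProduct]

lemma omegaLin_injective : Function.Injective (omegaLin d n) := by
  rw [injective_iff_map_eq_zero]
  intro v hv
  have h : ∀ w, omegaF v w = 0 := fun w => LinearMap.congr_fun hv w
  ext i
  · simpa [omegaF, dotp_eq_dotProduct] using h (0, Pi.single i 1)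
  · simpa [omegaF, dotp_eq_dotProduct] using h (Pi.single i 1, 0)

lemma castHom_dotp (p q : Fin n → ZMod (dp d)) :
    ZMod.castHom (d_dvd_dp d) (ZMod d) (dotp p q) =
      dotp (fun i => ZMod.castHom (d_dvd_dp d) (ZMod d) (p i))
        (fun i => ZMod.castHom (d_dvd_dp d) (ZMod d) (q i)) := by
  simp only [dotp, map_sum, map_mul]

lemma reduceV_add (v w : V (dp d) n) : reduceV d n (v + w) = reduceV d n v + reduceV d n w := by
  ext i <;> simp only [reduceV, Prod.fst_add, Prod.snd_add, Pi.add_apply, map_add]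

lemma reduceV_zero : reduceV d n 0 = 0 := by
  ext i <;> simp [reduceV]

lemma reduceV_natCast_smul (v : V (dp d) n) : reduceV d n ((d : ZMod (dp d)) • v) = 0 := by
  ext i <;> simp only [reduceV, Prod.smul_fst, Prod.smul_snd, Pi.smul_apply, smul_eq_mul, map_mul,
    map_natCast, CharP.cast_eq_zero, zero_mul, Prod.fst_zero, Prod.snd_zero, Pi.zero_apply]

lemma reduceV_liftV [NeZero d] (u : V d n) : reduceV d n (liftV d n u) = u := by
  ext i <;> simp [reduceV, liftV]

end Form

section Residues

variable (d : ℕ)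

instance [NeZero d] : NeZero (dp d) := ⟨by
  have := NeZero.ne d
  unfold dp; split <;> omega⟩

lemma natCast_mul_self_dp : (d : ZMod (dp d)) * d = 0 := by
  rw [← Nat.cast_mul, ZMod.natCast_eq_zero_iff]
  unfold dp
  split_ifs with h
  · exact Nat.mul_dvd_mul_right h.two_dvd d
  · exact dvd_mul_right d d

lemma exists_natCast_dp_eq_two_mul : ∃ y : ZMod (dp d), (d : ZMod (dp d)) = 2 * y := by
  by_cases h : Even d
  · obtain ⟨k, hk⟩ := h
    refine ⟨(k : ZMod (dp d)), ?_⟩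
    have := congrArg (Nat.cast : ℕ → ZMod (dp d)) hk
    push_cast at this
    rw [this, two_mul]
  · refine ⟨0, ?_⟩
    rw [mul_zero, ZMod.natCast_eq_zero_iff]
    simp [dp, h]

variable {d}

lemma exists_eq_two_mul_of_natCast_mul_eq_zero [NeZero d] (k : ZMod (dp d))
    (hk : (d : ZMod (dp d)) * k = 0) : ∃ m, k = 2 * m := by
  by_cases h : Even d
  · have h2 : d * 2 ∣ d * k.val := by
      have : ((d * k.val : ℕ) : ZMod (dp d)) = 0 := by simpa using hk
      rw [ZMod.natCast_eq_zero_iff] at this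
      simpa [dp, h, mul_comm] using this
    obtain ⟨m, hm⟩ := Nat.dvd_of_mul_dvd_mul_left (NeZero.pos d) h2
    refine ⟨(m : ZMod (dp d)), ?_⟩
    rw [← ZMod.natCast_zmod_val k, hm]
    push_cast; ring
  · obtain ⟨m, hm⟩ := Nat.not_even_iff_odd.mp h
    have h0 : (d : ZMod (dp d)) = 0 := by
      rw [ZMod.natCast_eq_zero_iff]
      simp [dp, h]
    have h1 : (2 * m + 1 : ZMod (dp d)) = 0 := by
      have := congrArg (Nat.cast : ℕ → ZMod (dp d)) hm
      push_cast at this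
      rw [← this, h0]
    exact ⟨-m * k, by linear_combination k * h1⟩

lemma exists_eq_natCast_mul_of_castHom_eq_zero [NeZero d] (a : ZMod (dp d))
    (ha : ZMod.castHom (d_dvd_dp d) (ZMod d) a = 0) : ∃ c, a = d * c := by
  rw [← ZMod.natCast_zmod_val a, map_natCast, ZMod.natCast_eq_zero_iff] at ha
  obtain ⟨c, hc⟩ := ha
  refine ⟨c, ?_⟩
  rw [← ZMod.natCast_zmod_val a, hc]
  push_cast; ring

end Residues

section Characters

variable (d : ℕ) [NeZero d]

lemma isPrimitiveRoot_zeta : IsPrimitiveRoot (zeta d) d :=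
  Complex.isPrimitiveRoot_exp d (NeZero.ne d)

lemma tau_sq : tau d ^ 2 = zeta d := by
  unfold tau
  split_ifs with h
  · rw [← Complex.exp_nat_mul, zeta]
    congr 1
    push_cast; ring
  · obtain ⟨m, hm⟩ := Nat.not_even_iff_odd.mp h
    rw [← pow_mul, show (d + 1) / 2 * 2 = d + 1 by omega, pow_succ,
      (isPrimitiveRoot_zeta d).pow_eq_one, one_mul]

lemma isPrimitiveRoot_tau : IsPrimitiveRoot (tau d) (dp d) := by
  unfold tau dp
  split_ifs with h
  · have := Complex.isPrimitiveRoot_exp (2 * d) (mul_ne_zero two_ne_zero (NeZero.ne d))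
    convert this using 2
    have : (d : ℂ) ≠ 0 := Nat.cast_ne_zero.mpr (NeZero.ne d)
    push_cast
    field_simp
  · obtain ⟨m, hm⟩ := Nat.not_even_iff_odd.mp h
    refine (isPrimitiveRoot_zeta d).pow_of_coprime _ ?_
    rw [show (d + 1) / 2 = m + 1 by omega, hm, show 2 * m + 1 = m + (m + 1) by ring]
    simp

/-- The additive character `a ↦ tau ^ a` of `ZMod (dp d)`. -/
def tauChar : AddChar (ZMod (dp d)) ℂ := AddChar.zmodChar _ (isPrimitiveRoot_tau d).pow_eq_one

/-- The additive character `a ↦ zeta ^ a` of `ZMod d`. -/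
def zetaChar : AddChar (ZMod d) ℂ := AddChar.zmodChar _ (isPrimitiveRoot_zeta d).pow_eq_one

variable {d}

lemma tauChar_apply (a : ZMod (dp d)) : tauChar d a = tau d ^ a.val := rfl

lemma zetaChar_apply (a : ZMod d) : zetaChar d a = zeta d ^ a.val := rfl

lemma tauChar_injective : Function.Injective (tauChar d) := fun a b h =>
  ZMod.val_injective _ ((isPrimitiveRoot_tau d).pow_inj (ZMod.val_lt a) (ZMod.val_lt b) h)

lemma zetaChar_injective : Function.Injective (zetaChar d) := fun a b h =>
  ZMod.val_injective _ ((isPrimitiveRoot_zeta d).pow_inj (ZMod.val_lt a) (ZMod.val_lt b) h)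

lemma zetaChar_castHom (a : ZMod (dp d)) :
    zetaChar d (ZMod.castHom (d_dvd_dp d) (ZMod d) a) = tauChar d (2 * a) := by
  rw [two_mul, AddChar.map_add_eq_mul, tauChar_apply, ← mul_pow, ← sq, tau_sq]
  nth_rewrite 1 [← ZMod.natCast_zmod_val a]
  rw [map_natCast]
  exact AddChar.zmodChar_apply' (isPrimitiveRoot_zeta d).pow_eq_one _

end Characters

section Displacement

variable {d n : ℕ} [NeZero d]

lemma Dop_zero : Dop d n 0 = 1 := by
  ext r s
  simp [Dop, Matrix.one_apply, dotp]

lemma Dop_mul (u v : V d n) :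
    Dop d n u * Dop d n v = zetaChar d (dotp u.2 v.1) • Dop d n (u + v) := by
  ext r s
  simp only [Matrix.mul_apply, Dop, Matrix.smul_apply, smul_eq_mul, mul_ite, ite_mul, mul_zero,
    zero_mul, ← zetaChar_apply, Finset.sum_ite_eq', Finset.mem_univ, if_true]
  rw [Prod.fst_add, add_comm u.1, ← add_assoc]
  split_ifs
  · rw [← AddChar.map_add_eq_mul, ← AddChar.map_add_eq_mul]
    congr 1
    simp only [dotp_eq_dotProduct, Prod.snd_add, add_dotProduct, dotProduct_add]
    ring
  · rfl

lemma Delta_eq (v : V (dp d) n) :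
    Delta d n v = tauChar d (dotp v.1 v.2) • Dop d n (reduceV d n v) := rfl

lemma Dop_eq (u : V d n) :
    Dop d n u = tauChar d (-dotp (liftV d n u).1 (liftV d n u).2) • Delta d n (liftV d n u) := by
  rw [Delta_eq, smul_smul, ← AddChar.map_add_eq_mul, neg_add_cancel, AddChar.map_zero_eq_one,
    one_smul, reduceV_liftV]

lemma Delta_zero : Delta d n 0 = 1 := by
  rw [Delta_eq, reduceV_zero, Dop_zero]
  simp [dotp]

lemma Delta_mul (v w : V (dp d) n) :
    Delta d n v * Delta d n w = tauChar d (omegaF v w) • Delta d n (v + w) := by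
  simp only [Delta_eq, Matrix.smul_mul, Matrix.mul_smul, Dop_mul, smul_smul, reduceV_add]
  congr 1
  have : dotp (reduceV d n v).2 (reduceV d n w).1 =
      ZMod.castHom (d_dvd_dp d) (ZMod d) (dotp v.2 w.1) := (castHom_dotp _ _).symm
  rw [this, zetaChar_castHom]
  simp only [← AddChar.map_add_eq_mul]
  congr 1
  simp only [omegaF, dotp_eq_dotProduct, Prod.snd_add, Prod.fst_add, add_dotProduct,
    dotProduct_add]
  rw [dotProduct_comm w.2, dotProduct_comm w.1 v.2]
  ring

lemma Delta_mul_swap (v w : V (dp d) n) :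
    Delta d n v * Delta d n w =
      zetaChar d (ZMod.castHom (d_dvd_dp d) (ZMod d) (omegaF v w)) •
        (Delta d n w * Delta d n v) := by
  rw [Delta_mul, Delta_mul, smul_smul, zetaChar_castHom, ← AddChar.map_add_eq_mul, add_comm w v,
    omegaF_swap w v]
  congr 2
  ring

lemma Delta_add (v w : V (dp d) n) :
    Delta d n (v + w) = tauChar d (-omegaF v w) • (Delta d n v * Delta d n w) := by
  rw [Delta_mul, smul_smul, ← AddChar.map_add_eq_mul, neg_add_cancel, AddChar.map_zero_eq_one,
    one_smul]

lemma Delta_pow (v : V (dp d) n) (k : ℕ) :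
    Delta d n v ^ k = Delta d n ((k : ZMod (dp d)) • v) := by
  induction k with
  | zero => simp [Delta_zero]
  | succ k ih =>
    have h : omegaF ((k : ZMod (dp d)) • v) v = 0 := by
      rw [← omegaLin_apply, map_smul, LinearMap.smul_apply, omegaLin_apply, omegaF_self, smul_zero]
    rw [pow_succ, ih, Delta_mul, h, AddChar.map_zero_eq_one, one_smul]
    congr 1
    push_cast
    rw [add_smul, one_smul]

lemma Delta_natCast_smul (v : V (dp d) n) : Delta d n ((d : ZMod (dp d)) • v) = 1 := by
  rw [Delta_eq, reduceV_natCast_smul, Dop_zero]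
  simp only [dotp_eq_dotProduct, Prod.smul_fst, Prod.smul_snd, smul_dotProduct, dotProduct_smul]
  rw [smul_smul, natCast_mul_self_dp, zero_smul, AddChar.map_zero_eq_one, one_smul]

lemma Delta_ne_zero (v : V (dp d) n) : Delta d n v ≠ 0 := fun h => by
  have := Delta_natCast_smul v
  rw [← Delta_pow, h, zero_pow (NeZero.ne d)] at this
  exact zero_ne_one this

lemma smul_Delta_injective (v : V (dp d) n) :
    Function.Injective fun c : ℂ => c • Delta d n v :=
  smul_left_injective ℂ (Delta_ne_zero v)

lemma exists_Delta_add_natCast_smul (v u : V (dp d) n) :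
    ∃ l : ZMod d, Delta d n v = zetaChar d l • Delta d n (v + (d : ZMod (dp d)) • u) := by
  obtain ⟨y, hy⟩ := exists_natCast_dp_eq_two_mul d
  refine ⟨ZMod.castHom (d_dvd_dp d) (ZMod d) (y * omegaF v u), ?_⟩
  have h := Delta_mul v ((d : ZMod (dp d)) • u)
  rw [Delta_natCast_smul, mul_one, ← omegaLin_apply, map_smul, omegaLin_apply, smul_eq_mul] at h
  rw [zetaChar_castHom, ← mul_assoc, ← hy]
  exact h

end Displacement

section PauliGroup

variable {d n : ℕ} [NeZero d]

lemma matVal_mul (g h : ↥(Pgrp d n)) : matVal (g * h) = matVal g * matVal h := rfl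

lemma matVal_one : matVal (1 : ↥(Pgrp d n)) = 1 := rfl

lemma matVal_pow (g : ↥(Pgrp d n)) (k : ℕ) : matVal (g ^ k) = matVal g ^ k := rfl

lemma matVal_injective : Function.Injective (matVal : ↥(Pgrp d n) → _) := fun _ _ h =>
  Subtype.ext (Units.ext h)

lemma exists_matVal_eq_Dop (u : V d n) : ∃ g : ↥(Pgrp d n), matVal g = Dop d n u := by
  have h₁ : Dop d n u * (zetaChar d (dotp u.2 u.1) • Dop d n (-u)) = 1 := by
    rw [Matrix.mul_smul, Dop_mul, smul_smul, ← AddChar.map_add_eq_mul, add_neg_cancel, Dop_zero,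
      Prod.fst_neg, dotp_eq_dotProduct, dotp_eq_dotProduct, dotProduct_neg, add_neg_cancel,
      AddChar.map_zero_eq_one, one_smul]
  exact ⟨⟨⟨_, _, h₁, mul_eq_one_comm.mp h₁⟩, Subgroup.subset_closure (Or.inr ⟨u, rfl⟩)⟩, rfl⟩

lemma exists_matVal_eq_tauChar (a : ZMod (dp d)) :
    ∃ g : ↥(Pgrp d n), matVal g = tauChar d a • 1 := by
  have h₁ : (tau d • 1 : Matrix (Fin n → ZMod d) (Fin n → ZMod d) ℂ) * ((tau d)⁻¹ • 1) = 1 := by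
    rw [smul_mul_smul_comm, mul_inv_cancel₀ ((isPrimitiveRoot_tau d).ne_zero (NeZero.ne _)),
      one_smul, one_mul]
  let g : ↥(Pgrp d n) :=
    ⟨⟨_, _, h₁, mul_eq_one_comm.mp h₁⟩, Subgroup.subset_closure (Or.inl rfl)⟩
  refine ⟨g ^ a.val, ?_⟩
  rw [matVal_pow, show matVal g = tau d • 1 from rfl, smul_pow, one_pow, tauChar_apply]

lemma exists_matVal_eq_Delta (v : V (dp d) n) : ∃ g : ↥(Pgrp d n), matVal g = Delta d n v := by
  obtain ⟨g, hg⟩ := exists_matVal_eq_Dop (reduceV d n v)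
  obtain ⟨s, hs⟩ := exists_matVal_eq_tauChar (n := n) (dotp v.1 v.2)
  exact ⟨s * g, by rw [matVal_mul, hs, hg, smul_mul_assoc, one_mul, Delta_eq]⟩

lemma exists_matVal_eq_tauChar_smul_Delta (g : ↥(Pgrp d n)) :
    ∃ a v, matVal g = tauChar d a • Delta d n v := by
  obtain ⟨x, hx⟩ := g
  change ∃ a v, (x : Matrix (Fin n → ZMod d) (Fin n → ZMod d) ℂ) = tauChar d a • Delta d n v
  induction hx using Subgroup.closure_induction with
  | mem x hx =>
    rcases hx with hx | ⟨u, hu⟩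
    · refine ⟨1, 0, ?_⟩
      have h : tauChar d 1 = tau d := by
        have := AddChar.zmodChar_apply' (isPrimitiveRoot_tau d).pow_eq_one 1
        rwa [Nat.cast_one, pow_one] at this
      rw [hx, Delta_zero, h]
    · exact ⟨_, _, hu.trans (Dop_eq u)⟩
  | one => exact ⟨0, 0, by simp [Delta_zero]⟩
  | mul x y _ _ hx hy =>
    obtain ⟨a, v, hx⟩ := hx
    obtain ⟨b, w, hy⟩ := hy
    refine ⟨a + b + omegaF v w, v + w, ?_⟩
    rw [Units.val_mul, hx, hy, smul_mul_smul_comm, Delta_mul, smul_smul, AddChar.map_add_eq_mul,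
      AddChar.map_add_eq_mul]
  | inv x _ hx =>
    obtain ⟨a, v, hx⟩ := hx
    refine ⟨-a, -v, ?_⟩
    have h : (x : Matrix (Fin n → ZMod d) (Fin n → ZMod d) ℂ) *
        (tauChar d (-a) • Delta d n (-v)) = 1 := by
      rw [hx, smul_mul_smul_comm, Delta_mul, show omegaF v (-v) = 0 from
        ((omegaLin _ n v).map_neg v).trans (neg_eq_zero.mpr (omegaF_self v)), ← AddChar.map_add_eq_mul, add_neg_cancel, add_neg_cancel,
        AddChar.map_zero_eq_one, one_smul, one_smul, Delta_zero]
    exact Units.inv_eq_of_mul_eq_one_right h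

lemma mem_center_of_matVal_eq_smul_one {z : ↥(Pgrp d n)} {c : ℂ} (hz : matVal z = c • 1) :
    z ∈ Subgroup.center ↥(Pgrp d n) :=
  Subgroup.mem_center_iff.mpr fun g => matVal_injective <| by
    rw [matVal_mul, matVal_mul, hz, smul_mul_assoc, mul_smul_comm, one_mul, mul_one]

variable {γ : ↥(Pgrp d n) ≃* ↥(Pgrp d n)}

lemma IsPCl.matVal_map_smul (hγ : IsPCl γ) {g h : ↥(Pgrp d n)} (a : ZMod (dp d))
    (hgh : matVal g = tauChar d a • matVal h) :
    matVal (γ g) = tauChar d a • matVal (γ h) := by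
  obtain ⟨s, hs⟩ := exists_matVal_eq_tauChar (n := n) a
  have : g = s * h := matVal_injective <| by rw [hgh, matVal_mul, hs, smul_mul_assoc, one_mul]
  rw [this, map_mul, hγ s (mem_center_of_matVal_eq_smul_one hs), matVal_mul, hs, smul_mul_assoc,
    one_mul]

lemma exists_matVal_map_eq_zetaChar_smul_Delta {v : V (dp d) n} {g : ↥(Pgrp d n)}
    (hg : matVal g = Delta d n v) : ∃ l w, matVal (γ g) = zetaChar d l • Delta d n w := by
  obtain ⟨a, w, h⟩ := exists_matVal_eq_tauChar_smul_Delta (γ g)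
  have hg1 : g ^ d = 1 := matVal_injective <| by
    rw [matVal_pow, hg, Delta_pow, Delta_natCast_smul, matVal_one]
  have h1 : (tauChar d a • Delta d n w) ^ d = 1 := by
    rw [← h, ← matVal_pow, ← map_pow, hg1, map_one, matVal_one]
  rw [smul_pow, Delta_pow, Delta_natCast_smul, ← AddChar.map_nsmul_eq_pow] at h1
  have h2 : tauChar d (d • a) = tauChar d 0 := by
    refine smul_Delta_injective (0 : V (dp d) n) ?_
    simpa [Delta_zero] using h1
  have h3 := tauChar_injective h2
  rw [nsmul_eq_mul] at h3
  obtain ⟨m, rfl⟩ := exists_eq_two_mul_of_natCast_mul_eq_zero a h3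
  exact ⟨_, w, by rw [h, zetaChar_castHom]⟩

lemma IsPCl.castHom_omegaF_eq (hγ : IsPCl γ) {v w v' w' : V (dp d) n} {g h : ↥(Pgrp d n)}
    {l m : ZMod d} (hg : matVal g = Delta d n v) (hh : matVal h = Delta d n w)
    (hg' : matVal (γ g) = zetaChar d l • Delta d n v')
    (hh' : matVal (γ h) = zetaChar d m • Delta d n w') :
    ZMod.castHom (d_dvd_dp d) (ZMod d) (omegaF v' w') =
      ZMod.castHom (d_dvd_dp d) (ZMod d) (omegaF v w) := by
  have key : matVal (g * h) = tauChar d (2 * omegaF v w) • matVal (h * g) := by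
    rw [matVal_mul, matVal_mul, hg, hh, Delta_mul_swap, zetaChar_castHom]
  have := hγ.matVal_map_smul _ key
  rw [map_mul γ, map_mul γ, matVal_mul, matVal_mul, hg', hh', smul_mul_smul_comm, smul_mul_smul_comm,
    Delta_mul_swap, mul_comm (zetaChar d m), smul_comm, ← zetaChar_castHom, Delta_mul w',
    smul_smul, smul_smul, smul_smul, smul_smul] at this
  have := smul_Delta_injective _ this
  refine zetaChar_injective ?_
  have hne : ∀ a, tauChar d a ≠ 0 := fun a => (tauChar d).val_isUnit a |>.ne_zero
  have hne' : ∀ a, zetaChar d a ≠ 0 := fun a => (zetaChar d).val_isUnit a |>.ne_zero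
  have hc := mul_ne_zero (mul_ne_zero (hne' l) (hne' m)) (hne (omegaF w' v'))
  refine mul_right_cancel₀ hc ?_
  linear_combination this

end PauliGroup

theorem exists_symplectic_encoding (d n : ℕ) [NeZero d] (hd : 2 ≤ d) (hn : 1 ≤ n)
    (γ : ↥(Pgrp d n) ≃* ↥(Pgrp d n)) (hγ : IsPCl γ) :
    ∃ (lam : V (dp d) n →+ ZMod d) (φ : V (dp d) n ≃ₗ[ZMod (dp d)] V (dp d) n),
      IsSymp (dp d) n φ ∧
      ∀ v : V (dp d) n, ∀ g : ↥(Pgrp d n), matVal g = Delta d n v →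
        matVal (γ g) = zeta d ^ (lam v).val • Delta d n (φ v) := by
  have : Fact (1 < dp d) := ⟨by unfold dp; split <;> omega⟩
  let b := Module.finBasis (ZMod (dp d)) (V (dp d) n)
  choose D hD using exists_matVal_eq_Delta (d := d) (n := n)
  choose l w hw using fun v => exists_matVal_map_eq_zetaChar_smul_Delta (γ := γ) (hD v)
  obtain ⟨φ, hφ, hφb⟩ := exists_isometry_congr b (omegaLin (dp d) n) omegaF_self
    omegaLin_surjective d (natCast_mul_self_dp d) (fun i => w (b i)) fun i j => by
      refine exists_eq_natCast_mul_of_castHom_eq_zero _ ?_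
      rw [map_sub, sub_eq_zero]
      exact hγ.castHom_omegaF_eq (hD _) (hD _) (hw _) (hw _)
  have hadd : ∀ {u v : V (dp d) n} {l m : ZMod d},
      matVal (γ (D u)) = zetaChar d l • Delta d n (φ u) →
      matVal (γ (D v)) = zetaChar d m • Delta d n (φ v) →
      matVal (γ (D (u + v))) = zetaChar d (l + m) • Delta d n (φ (u + v)) := by
    intro u v l m hu hv
    have h : matVal (D (u + v)) = tauChar d (-omegaF u v) • matVal (D u * D v) := by
      rw [matVal_mul, hD, hD, hD, Delta_add]
    have hω : omegaF (φ u) (φ v) = omegaF u v := hφ u v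
    rw [hγ.matVal_map_smul _ h, map_mul, matVal_mul, hu, hv, smul_mul_smul_comm, map_add φ,
      Delta_add, hω, smul_comm, AddChar.map_add_eq_mul]
  have hex : ∀ v, ∃ l, matVal (γ (D v)) = zetaChar d l • Delta d n (φ v) := by
    let S : AddSubmonoid (V (dp d) n) :=
      { carrier := {v | ∃ l, matVal (γ (D v)) = zetaChar d l • Delta d n (φ v)}
        zero_mem' := by
          have h : D 0 = 1 := matVal_injective <| by rw [hD, Delta_zero, matVal_one]
          exact ⟨0, by rw [h, map_one, map_zero φ, matVal_one, Delta_zero, AddChar.map_zero_eq_one,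
            one_smul]⟩
        add_mem' := fun ⟨_, hu⟩ ⟨_, hv⟩ => ⟨_, hadd hu hv⟩ }
    have hb : ∀ i, b i ∈ S := fun i => by
      obtain ⟨u, hu⟩ := hφb i
      obtain ⟨m, hm⟩ := exists_Delta_add_natCast_smul (w (b i)) u
      exact ⟨l (b i) + m, by rw [hw, hm, hu, smul_smul, AddChar.map_add_eq_mul]⟩
    intro v
    change v ∈ S
    rw [← b.sum_repr v]
    refine sum_mem fun i _ => ?_
    rw [← ZMod.natCast_zmod_val (b.repr v i), Nat.cast_smul_eq_nsmul]
    exact nsmul_mem (hb i) _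
  choose f hf using hex
  have hinj : Function.Injective φ := fun u v huv => omegaLin_injective <| LinearMap.ext fun x => by
    rw [← hφ, huv, hφ]
  refine ⟨AddMonoidHom.mk' f fun u v => zetaChar_injective <| smul_Delta_injective _ <|
      (hf (u + v)).symm.trans (hadd (hf u) (hf v)),
    LinearEquiv.ofBijective φ (Finite.injective_iff_bijective.mp hinj), hφ, fun v g hg => ?_⟩
  rw [show g = D v from matVal_injective (hg.trans (hD v).symm)]
  exact hf v

end PaperPCl
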